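/- Let B be the open unit ball in ℂ^n, let φ: B → ℝ be smooth with positive definite complex Hessian g_{ij̄} = ∂_i∂_j̄φ at every point, and set h = exp(−φ). Define the (n+1)×(n+1) matrix-valued function K = (K^{ab̄})_{0≤a,b≤n} on B by K^{ab̄} = h^{-1} u_a conj(u_b) − h^{-1} g^{pq̄}(∂_p u_a − u_a h^{-1}∂_p h)·conj(∂_q u_b − u_b h^{-1}∂_q h), where u_0 = 1 and u_i = z^i for 1 ≤ i ≤ n. Then, wherever K is invertible, the Chern curvature F_{kl̄} = ∂_l̄((∂_k K)·K^{-1}) vanishes identically on B for all k, l if and only if R_{ij̄kl̄} = −(g_{ij̄}g_{kl̄} + g_{il̄}g_{kj̄}) on B for all indices i,j,k,l (i.e. g has constant holomorphic sectional curvature κ = −2). -/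

import Mathlib

noncomputable section
open Complex Matrix
open scoped ComplexOrder

/-- The Wirtinger derivative `∂ₖ f = (1/2)(∂f/∂xᵏ − i ∂f/∂yᵏ)` of a complex-valued
function on `ℂⁿ` (with its Euclidean structure), where `zᵏ = xᵏ + i yᵏ`. -/
def wd {n : ℕ} (k : Fin n) (f : EuclideanSpace ℂ (Fin n) → ℂ)
    (z : EuclideanSpace ℂ (Fin n)) : ℂ :=
  (1/2 : ℂ) * (fderiv ℝ f z (EuclideanSpace.single k 1)
    - Complex.I * fderiv ℝ f z (EuclideanSpace.single k Complex.I))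

/-- The conjugate Wirtinger derivative `∂ₖ̄ f = (1/2)(∂f/∂xᵏ + i ∂f/∂yᵏ)`. -/
def wdb {n : ℕ} (k : Fin n) (f : EuclideanSpace ℂ (Fin n) → ℂ)
    (z : EuclideanSpace ℂ (Fin n)) : ℂ :=
  (1/2 : ℂ) * (fderiv ℝ f z (EuclideanSpace.single k 1)
    + Complex.I * fderiv ℝ f z (EuclideanSpace.single k Complex.I))

/-- The inverse transpose matrix `(g^{ij̄})` of a matrix-valued function `(g_{ij̄})`. -/
def ginv {n : ℕ} (g : Fin n → Fin n → EuclideanSpace ℂ (Fin n) → ℂ)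
    (z : EuclideanSpace ℂ (Fin n)) : Matrix (Fin n) (Fin n) ℂ :=
  ((Matrix.of fun i j => g i j z)⁻¹)ᵀ

/-- The Riemann curvature tensor
`R_{ij̄kl̄} = −∂_k∂_l̄ g_{ij̄} + g^{pq̄}(∂_l̄ g_{pj̄})(∂_k g_{iq̄})`. -/
def Riem {n : ℕ} (g : Fin n → Fin n → EuclideanSpace ℂ (Fin n) → ℂ)
    (i j k l : Fin n) (z : EuclideanSpace ℂ (Fin n)) : ℂ :=
  - wd k (wdb l (g i j)) z
    + ∑ p, ∑ q, ginv g z p q * wdb l (g p j) z * wd k (g i q) z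

/-- The complex Hessian `g_{ij̄} = ∂_i ∂_j̄ φ` of a real-valued function `φ`. -/
def gmat {n : ℕ} (φ : EuclideanSpace ℂ (Fin n) → ℝ) (i j : Fin n)
    (z : EuclideanSpace ℂ (Fin n)) : ℂ :=
  wd i (wdb j (fun w => (φ w : ℂ))) z

/-- The functions `u_0 = 1`, `u_i = z^i` (`1 ≤ i ≤ n`), indexed by `Fin (n+1)`. -/
def uu {n : ℕ} (a : Fin (n + 1)) (z : EuclideanSpace ℂ (Fin n)) : ℂ :=
  if h : a = 0 then 1 else z (a.pred h)

/-- The matrix `H^{ab̄} = h u_a conj(u_b)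
  + h g^{pq̄}(∂_p u_a + u_a h⁻¹ ∂_p h) conj(∂_q u_b + u_b h⁻¹ ∂_q h)`. -/
def Hmat {n : ℕ} (h : EuclideanSpace ℂ (Fin n) → ℝ)
    (g : Fin n → Fin n → EuclideanSpace ℂ (Fin n) → ℂ)
    (a b : Fin (n + 1)) (z : EuclideanSpace ℂ (Fin n)) : ℂ :=
  (h z : ℂ) * uu a z * (starRingEnd ℂ) (uu b z)
    + (h z : ℂ) * ∑ p, ∑ q, ginv g z p q
        * (wd p (uu a) z + uu a z * (h z : ℂ)⁻¹ * wd p (fun w => (h w : ℂ)) z)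
        * (starRingEnd ℂ)
            (wd q (uu b) z + uu b z * (h z : ℂ)⁻¹ * wd q (fun w => (h w : ℂ)) z)

/-- The matrix `K^{ab̄} = h⁻¹ u_a conj(u_b)
  − h⁻¹ g^{pq̄}(∂_p u_a − u_a h⁻¹ ∂_p h) conj(∂_q u_b − u_b h⁻¹ ∂_q h)`. -/
def Kmat {n : ℕ} (h : EuclideanSpace ℂ (Fin n) → ℝ)
    (g : Fin n → Fin n → EuclideanSpace ℂ (Fin n) → ℂ)
    (a b : Fin (n + 1)) (z : EuclideanSpace ℂ (Fin n)) : ℂ :=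
  (h z : ℂ)⁻¹ * uu a z * (starRingEnd ℂ) (uu b z)
    - (h z : ℂ)⁻¹ * ∑ p, ∑ q, ginv g z p q
        * (wd p (uu a) z - uu a z * (h z : ℂ)⁻¹ * wd p (fun w => (h w : ℂ)) z)
        * (starRingEnd ℂ)
            (wd q (uu b) z - uu b z * (h z : ℂ)⁻¹ * wd q (fun w => (h w : ℂ)) z)

/-- The Chern curvature `F_{kl̄} = ∂_l̄ ((∂_k K) · K⁻¹)` of the matrix `K`. -/
def FK {n : ℕ} (h : EuclideanSpace ℂ (Fin n) → ℝ)
    (g : Fin n → Fin n → EuclideanSpace ℂ (Fin n) → ℂ)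
    (k l : Fin n) (z : EuclideanSpace ℂ (Fin n)) :
    Matrix (Fin (n + 1)) (Fin (n + 1)) ℂ :=
  Matrix.of fun a b => wdb l (fun w =>
    ((Matrix.of fun a' b' => wd k (Kmat h g a' b') w)
      * (Matrix.of fun a' b' => Kmat h g a' b' w)⁻¹) a b) z


/-! ### Wirtinger calculus -/

/-- common form of both Wirtinger operators -/
def WW {n : ℕ} (c : ℂ) (k : Fin n) (f : EuclideanSpace ℂ (Fin n) → ℂ)
    (z : EuclideanSpace ℂ (Fin n)) : ℂ :=
  (1/2 : ℂ) * (fderiv ℝ f z (EuclideanSpace.single k 1)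
    + c * fderiv ℝ f z (EuclideanSpace.single k Complex.I))

theorem wd_eq {n : ℕ} (k : Fin n) : wd k = WW (-Complex.I) k := by
  funext f z; simp only [wd, WW]; ring

theorem wdb_eq {n : ℕ} (k : Fin n) : wdb k = WW (Complex.I) k := by
  funext f z; simp only [wdb, WW]

/-- the open unit ball -/
abbrev BB (n : ℕ) : Set (EuclideanSpace ℂ (Fin n)) := Metric.ball 0 1

/-- smooth on the ball -/
def Sm {n : ℕ} (f : EuclideanSpace ℂ (Fin n) → ℂ) : Prop :=
  ContDiffOn ℝ (⊤ : ℕ∞) f (BB n)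

section WCalc
variable {n : ℕ} {f g : EuclideanSpace ℂ (Fin n) → ℂ} {z : EuclideanSpace ℂ (Fin n)}
  {c d : ℂ} {k l : Fin n}

theorem Sm.cd (hf : Sm f) (hz : z ∈ BB n) : ContDiffAt ℝ (⊤ : ℕ∞) f z :=
  ContDiffOn.contDiffAt hf (Metric.isOpen_ball.mem_nhds hz)

theorem Sm.da (hf : Sm f) (hz : z ∈ BB n) : DifferentiableAt ℝ f z :=
  (hf.cd hz).differentiableAt (by simp)

theorem Sm.fd (hf : Sm f) : ContDiffOn ℝ (⊤ : ℕ∞) (fderiv ℝ f) (BB n) :=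
  ContDiffOn.fderiv_of_isOpen hf Metric.isOpen_ball (by simp)

theorem Sm.ap (hf : Sm f) (v) : Sm (fun w => fderiv ℝ f w v) :=
  ContDiffOn.clm_apply hf.fd contDiffOn_const

theorem Sm.const (a : ℂ) : Sm (fun _ : EuclideanSpace ℂ (Fin n) => a) := contDiffOn_const

theorem Sm.add (hf : Sm f) (hg : Sm g) : Sm (fun w => f w + g w) := ContDiffOn.add hf hg

theorem Sm.sub (hf : Sm f) (hg : Sm g) : Sm (fun w => f w - g w) := ContDiffOn.sub hf hg

theorem Sm.neg (hf : Sm f) : Sm (fun w => - f w) := ContDiffOn.neg hf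

theorem Sm.mul (hf : Sm f) (hg : Sm g) : Sm (fun w => f w * g w) := ContDiffOn.mul hf hg

theorem Sm.inv (hf : Sm f) (h : ∀ w ∈ BB n, f w ≠ 0) : Sm (fun w => (f w)⁻¹) :=
  ContDiffOn.inv hf h

theorem Sm.sum {ι : Type*} {s : Finset ι} {F : ι → EuclideanSpace ℂ (Fin n) → ℂ}
    (h : ∀ i ∈ s, Sm (F i)) : Sm (fun w => ∑ i ∈ s, F i w) := ContDiffOn.sum h

theorem Sm.prod {ι : Type*} {s : Finset ι} {F : ι → EuclideanSpace ℂ (Fin n) → ℂ}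
    (h : ∀ i ∈ s, Sm (F i)) : Sm (fun w => ∏ i ∈ s, F i w) := contDiffOn_prod h

theorem Sm.congr (hf : Sm f) (h : ∀ w ∈ BB n, g w = f w) : Sm g := ContDiffOn.congr hf h

theorem Sm.ww (hf : Sm f) : Sm (WW c k f) :=
  (Sm.const _).mul ((hf.ap _).add ((Sm.const _).mul (hf.ap _)))

theorem ww_congr (h : ∀ w ∈ BB n, f w = g w) (hz : z ∈ BB n) : WW c k f z = WW c k g z := by
  have : f =ᶠ[nhds z] g := Filter.eventuallyEq_of_mem (Metric.isOpen_ball.mem_nhds hz) h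
  simp only [WW, this.fderiv_eq]

theorem ww_const (a : ℂ) : WW c k (fun _ => a) z = 0 := by
  simp [WW]

theorem ww_add (hf : Sm f) (hg : Sm g) (hz : z ∈ BB n) :
    WW c k (fun w => f w + g w) z = WW c k f z + WW c k g z := by
  simp only [WW, fderiv_fun_add (hf.da hz) (hg.da hz), _root_.add_apply]; ring

theorem ww_sub (hf : Sm f) (hg : Sm g) (hz : z ∈ BB n) :
    WW c k (fun w => f w - g w) z = WW c k f z - WW c k g z := by
  simp only [WW, fderiv_fun_sub (hf.da hz) (hg.da hz), _root_.sub_apply]; ring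

theorem ww_neg : WW c k (fun w => - f w) z = - WW c k f z := by
  simp only [WW, fderiv_fun_neg, _root_.neg_apply]; ring

theorem ww_mul (hf : Sm f) (hg : Sm g) (hz : z ∈ BB n) :
    WW c k (fun w => f w * g w) z = WW c k f z * g z + f z * WW c k g z := by
  simp only [WW, fderiv_fun_mul (hf.da hz) (hg.da hz), _root_.add_apply,
    _root_.smul_apply, smul_eq_mul]; ring

theorem ww_sum {ι : Type*} {s : Finset ι} {F : ι → EuclideanSpace ℂ (Fin n) → ℂ}
    (h : ∀ i ∈ s, Sm (F i)) (hz : z ∈ BB n) :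
    WW c k (fun w => ∑ i ∈ s, F i w) z = ∑ i ∈ s, WW c k (F i) z := by
  classical
  induction s using Finset.induction_on with
  | empty => simp [ww_const]
  | insert a s ha ih =>
    simp only [Finset.sum_insert ha]
    rw [ww_add (h a (by simp)) (Sm.sum fun i hi => h i (by simp [hi])) hz,
      ih fun i hi => h i (by simp [hi])]

theorem fderiv_ap (hf : Sm f) (hz : z ∈ BB n) (u v) :
    fderiv ℝ (fun w => fderiv ℝ f w v) z u = fderiv ℝ (fderiv ℝ f) z u v := by
  have h1 : DifferentiableAt ℝ (fderiv ℝ f) z :=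
    (hf.fd.contDiffAt (Metric.isOpen_ball.mem_nhds hz)).differentiableAt (by simp)
  rw [fderiv_clm_apply h1 (differentiableAt_const v)]
  simp

theorem fderiv_comm (hf : Sm f) (hz : z ∈ BB n) (u v) :
    fderiv ℝ (fderiv ℝ f) z u v = fderiv ℝ (fderiv ℝ f) z v u := by
  have := (hf.cd hz).isSymmSndFDerivAt (by
    simpa using (WithTop.coe_le_coe.2 (le_top : (2 : ℕ∞) ≤ ⊤)))
  exact this.eq u v

theorem ww_comm (hf : Sm f) (hz : z ∈ BB n) :
    WW c k (WW d l f) z = WW d l (WW c k f) z := by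
  have key : ∀ (c d : ℂ) (k l : Fin n), WW c k (WW d l f) z =
      (1/2 : ℂ) * (1/2) * (fderiv ℝ (fderiv ℝ f) z (EuclideanSpace.single k 1) (EuclideanSpace.single l 1)
       + d * fderiv ℝ (fderiv ℝ f) z (EuclideanSpace.single k 1) (EuclideanSpace.single l Complex.I)
       + c * fderiv ℝ (fderiv ℝ f) z (EuclideanSpace.single k Complex.I) (EuclideanSpace.single l 1)
       + c * d * fderiv ℝ (fderiv ℝ f) z (EuclideanSpace.single k Complex.I) (EuclideanSpace.single l Complex.I)) := by
    intro c d k l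
    change WW c k (fun w => (1/2 : ℂ) * (fderiv ℝ f w (EuclideanSpace.single l 1)
      + d * fderiv ℝ f w (EuclideanSpace.single l Complex.I))) z = _
    rw [ww_mul (Sm.const _) ((hf.ap _).add ((Sm.const _).mul (hf.ap _))) hz, ww_const,
      ww_add (hf.ap _) ((Sm.const _).mul (hf.ap _)) hz, ww_mul (Sm.const _) (hf.ap _) hz, ww_const]
    simp only [WW, fderiv_ap hf hz]
    ring
  rw [key, key, fderiv_comm hf hz (EuclideanSpace.single k 1) (EuclideanSpace.single l 1),
    fderiv_comm hf hz (EuclideanSpace.single k Complex.I) (EuclideanSpace.single l 1),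
    fderiv_comm hf hz (EuclideanSpace.single k 1) (EuclideanSpace.single l Complex.I),
    fderiv_comm hf hz (EuclideanSpace.single k Complex.I) (EuclideanSpace.single l Complex.I)]
  ring

theorem ww_conj (hf : Sm f) (hz : z ∈ BB n) :
    WW c k (fun w => (starRingEnd ℂ) (f w)) z
      = (starRingEnd ℂ) (WW ((starRingEnd ℂ) c) k f z) := by
  have : HasFDerivAt (fun w => (starRingEnd ℂ) (f w))
      ((Complex.conjCLE : ℂ →L[ℝ] ℂ).comp (fderiv ℝ f z)) z :=
    (Complex.conjCLE : ℂ →L[ℝ] ℂ).hasFDerivAt.comp z (hf.da hz).hasFDerivAt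
  simp only [WW, this.fderiv]
  simp [map_ofNat]

theorem Sm.conj (hf : Sm f) : Sm (fun w => (starRingEnd ℂ) (f w)) :=
  (Complex.conjCLE : ℂ →L[ℝ] ℂ).contDiff.comp_contDiffOn hf

theorem Sm.coord (i : Fin n) : Sm (fun w : EuclideanSpace ℂ (Fin n) => w i) :=
  ((EuclideanSpace.proj i : EuclideanSpace ℂ (Fin n) →L[ℂ] ℂ).restrictScalars ℝ).contDiff.contDiffOn

theorem ww_coord (i : Fin n) : WW c k (fun w : EuclideanSpace ℂ (Fin n) => w i) z
    = if i = k then (1/2) * (1 + c * Complex.I) else 0 := by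
  have : HasFDerivAt (fun w : EuclideanSpace ℂ (Fin n) => w i)
     ((EuclideanSpace.proj i : EuclideanSpace ℂ (Fin n) →L[ℂ] ℂ).restrictScalars ℝ) z :=
    ((EuclideanSpace.proj i : EuclideanSpace ℂ (Fin n) →L[ℂ] ℂ).restrictScalars ℝ).hasFDerivAt
  rw [WW, this.fderiv]
  by_cases h : i = k <;> simp [h]

end WCalc

/-! ### Matrix-valued functions -/

/-- entrywise derivative -/
def WM {n m : ℕ} (c : ℂ) (k : Fin n)
    (M : EuclideanSpace ℂ (Fin n) → Matrix (Fin m) (Fin m) ℂ)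
    (z : EuclideanSpace ℂ (Fin n)) : Matrix (Fin m) (Fin m) ℂ :=
  Matrix.of fun a b => WW c k (fun w => M w a b) z

/-- entrywise smooth -/
def MS {n m : ℕ} (M : EuclideanSpace ℂ (Fin n) → Matrix (Fin m) (Fin m) ℂ) : Prop :=
  ∀ a b, Sm (fun w => M w a b)

section mcalc
variable {n m : ℕ} {M P : EuclideanSpace ℂ (Fin n) → Matrix (Fin m) (Fin m) ℂ}
  {z : EuclideanSpace ℂ (Fin n)} {c d : ℂ} {k l : Fin n}

theorem MS.mul (hM : MS M) (hP : MS P) : MS (fun w => M w * P w) := fun a b => by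
  simp only [Matrix.mul_apply]
  exact Sm.sum fun i _ => (hM a i).mul (hP i b)

theorem MS.sub (hM : MS M) (hP : MS P) : MS (fun w => M w - P w) := fun a b =>
  (hM a b).sub (hP a b)

theorem MS.wm (hM : MS M) : MS (WM c k M) := fun a b => (hM a b).ww

theorem MS.congr (hM : MS M) (h : ∀ w ∈ BB n, P w = M w) : MS P := fun a b =>
  (hM a b).congr fun w hw => by rw [h w hw]

theorem det_sm (hM : MS M) : Sm (fun w => (M w).det) := by
  simp only [Matrix.det_apply']
  exact Sm.sum fun σ _ => (Sm.const _).mul (Sm.prod fun i _ => hM _ _)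

theorem MS.inv (hM : MS M) (h : ∀ w ∈ BB n, IsUnit (M w).det) : MS (fun w => (M w)⁻¹) := by
  intro a b
  have : (fun w => (M w)⁻¹ a b) =
      fun w => ((M w).det)⁻¹ * ((M w).updateRow b (Pi.single a 1)).det := by
    funext w
    rw [Matrix.inv_def, Matrix.smul_apply, Ring.inverse_eq_inv', Matrix.adjugate_apply,
      smul_eq_mul]
  rw [this]
  refine ((det_sm hM).inv fun w hw => (h w hw).ne_zero).mul (det_sm ?_)
  intro i j
  by_cases hi : i = b
  · subst hi; simp only [Matrix.updateRow_self]; exact Sm.const _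
  · simp only [Matrix.updateRow_ne hi]; exact hM i j

theorem wm_mul (hM : MS M) (hP : MS P) (hz : z ∈ BB n) :
    WM c k (fun w => M w * P w) z = WM c k M z * P z + M z * WM c k P z := by
  ext a b
  simp only [WM, Matrix.mul_apply, Matrix.of_apply, Matrix.add_apply]
  rw [ww_sum (fun i _ => (hM a i).mul (hP i b)) hz, ← Finset.sum_add_distrib]
  exact Finset.sum_congr rfl fun i _ => ww_mul (hM a i) (hP i b) hz

theorem wm_sub (hM : MS M) (hP : MS P) (hz : z ∈ BB n) :
    WM c k (fun w => M w - P w) z = WM c k M z - WM c k P z := by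
  ext a b
  exact ww_sub (hM a b) (hP a b) hz

theorem wm_congr (h : ∀ w ∈ BB n, M w = P w) (hz : z ∈ BB n) : WM c k M z = WM c k P z := by
  ext a b
  exact ww_congr (fun w hw => by rw [h w hw]) hz

theorem wm_const (X : Matrix (Fin m) (Fin m) ℂ) : WM c k (fun _ => X) z = 0 := by
  ext a b
  exact ww_const _

theorem wm_comm (hM : MS M) (hz : z ∈ BB n) : WM c k (WM d l M) z = WM d l (WM c k M) z := by
  ext a b
  exact ww_comm (hM a b) hz

/-- derivative of the inverse -/
theorem wm_inv (hM : MS M) (hP : MS P) (h : ∀ w ∈ BB n, M w * P w = 1) (hz : z ∈ BB n) :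
    WM c k M z = - (M z * WM c k P z * M z) := by
  have h1 := wm_congr (c := c) (k := k) h hz
  rw [wm_mul hM hP hz, wm_const] at h1
  have h2 : P z * M z = 1 := mul_eq_one_comm.mp (h z hz)
  have h3 := congrArg (· * M z) h1
  simp only [add_mul, mul_assoc, h2, mul_one, zero_mul] at h3
  rw [eq_neg_iff_add_eq_zero, mul_assoc]; exact h3

/-- the abstract curvature computation -/
theorem flat_formula {K A L C N A' C' : EuclideanSpace ℂ (Fin n) → Matrix (Fin m) (Fin m) ℂ}
    (hA : MS A) (hL : MS L) (hC : MS C) (hN : MS N) (hA' : MS A')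
    (hK : ∀ w ∈ BB n, K w = A w * L w * C w)
    (hAA : ∀ w ∈ BB n, A w * A' w = 1) (hCC : ∀ w ∈ BB n, C w * C' w = 1)
    (hLN : ∀ w ∈ BB n, L w * N w = 1)
    (hdC : ∀ w ∈ BB n, WM c k C w = 0) (hdA : ∀ w ∈ BB n, WM d l A w = 0) (hz : z ∈ BB n) :
    WM d l (fun w => WM c k K w * (K w)⁻¹) z
      = - (A z * L z * (WM d l (WM c k N) z - WM d l N z * L z * WM c k N z) * A' z) := by
  have hinv : ∀ w ∈ BB n, (K w)⁻¹ = C' w * N w * A' w := by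
    intro w hw
    apply Matrix.inv_eq_right_inv
    rw [hK w hw]
    calc A w * L w * C w * (C' w * N w * A' w)
        = A w * (L w * (C w * C' w) * N w) * A' w := by simp only [mul_assoc]
      _ = 1 := by rw [hCC w hw, mul_one, hLN w hw, mul_one, hAA w hw]
  have e1 : ∀ w ∈ BB n, WM c k K w * (K w)⁻¹
      = WM c k A w * A' w - A w * L w * WM c k N w * A' w := by
    intro w hw
    rw [hinv w hw, wm_congr hK hw, wm_mul (hA.mul hL) hC hw, hdC w hw, mul_zero, add_zero,
      wm_mul hA hL hw, wm_inv hL hN hLN hw]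
    calc _ = (WM c k A w * (L w * (C w * C' w) * N w)
        - A w * L w * WM c k N w * (L w * (C w * C' w) * N w)) * A' w := by noncomm_ring
      _ = _ := by rw [hCC w hw, mul_one, hLN w hw, mul_one, mul_one, sub_mul]
  have hdA' : WM d l A' z = 0 := by
    have h' : ∀ w ∈ BB n, A' w * A w = 1 := fun w hw => mul_eq_one_comm.mp (hAA w hw)
    rw [wm_inv hA' hA h' hz, hdA z hz]; simp
  have hddA : WM d l (WM c k A) z = 0 := by
    rw [wm_comm hA hz, wm_congr (P := fun _ => 0) hdA hz, wm_const]
  rw [wm_congr e1 hz, wm_sub (hA.wm.mul hA') (((hA.mul hL).mul hN.wm).mul hA') hz,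
    wm_mul hA.wm hA' hz, wm_mul ((hA.mul hL).mul hN.wm) hA' hz,
    wm_mul (hA.mul hL) hN.wm hz, wm_mul hA hL hz, hdA', hddA, hdA z hz, wm_inv hL hN hLN hz]
  noncomm_ring

theorem flat_iff {K A L C N A' C' : EuclideanSpace ℂ (Fin n) → Matrix (Fin m) (Fin m) ℂ}
    (hA : MS A) (hL : MS L) (hC : MS C) (hN : MS N) (hA' : MS A')
    (hK : ∀ w ∈ BB n, K w = A w * L w * C w)
    (hAA : ∀ w ∈ BB n, A w * A' w = 1) (hCC : ∀ w ∈ BB n, C w * C' w = 1)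
    (hLN : ∀ w ∈ BB n, L w * N w = 1)
    (hdC : ∀ w ∈ BB n, WM c k C w = 0) (hdA : ∀ w ∈ BB n, WM d l A w = 0) (hz : z ∈ BB n) :
    WM d l (fun w => WM c k K w * (K w)⁻¹) z = 0
      ↔ WM d l (WM c k N) z - WM d l N z * L z * WM c k N z = 0 := by
  rw [flat_formula hA hL hC hN hA' hK hAA hCC hLN hdC hdA hz]
  have h1 : A' z * A z = 1 := mul_eq_one_comm.mp (hAA z hz)
  have h2 : N z * L z = 1 := mul_eq_one_comm.mp (hLN z hz)
  generalize WM d l (WM c k N) z - WM d l N z * L z * WM c k N z = X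
  constructor
  · intro h
    calc X = N z * L z * X * (A' z * A z) := by rw [h1, h2]; simp
      _ = N z * ((A' z * A z) * L z * X * (A' z * A z)) := by rw [h1]; noncomm_ring
      _ = N z * A' z * (A z * L z * X * A' z) * A z := by noncomm_ring
      _ = 0 := by rw [neg_eq_zero.mp h]; simp
  · rintro rfl; simp

end mcalc

/-! ### Pointwise block matrices -/

/-- the block matrix `[[1, x], [0, 1]]` -/
def Bm {n : ℕ} (x : Fin n → ℂ) : Matrix (Fin (n + 1)) (Fin (n + 1)) ℂ :=
  Matrix.of fun a b => Fin.cases (if a = 0 then 1 else 0)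
    (fun p => Fin.cases (x p) (fun i => if i = p then 1 else 0) a) b

/-- the block matrix `[[1, 0], [0, -g]]` -/
def Dm {n : ℕ} (g : Matrix (Fin n) (Fin n) ℂ) : Matrix (Fin (n + 1)) (Fin (n + 1)) ℂ :=
  Matrix.of fun a b => Fin.cases (Fin.cases 1 (fun _ => 0) b)
    (fun p => Fin.cases 0 (fun q => - g p q) b) a

section block
variable {n : ℕ} (x y : Fin n → ℂ) (g g' : Matrix (Fin n) (Fin n) ℂ)
  (S T : Matrix (Fin (n + 1)) (Fin (n + 1)) ℂ) (a b : Fin (n + 1)) (i j : Fin n)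

theorem Bm_zero_zero : Bm x 0 0 = 1 := rfl
theorem Bm_succ_zero : Bm x i.succ 0 = 0 := by simp [Bm]
theorem Bm_zero_succ : Bm x 0 i.succ = x i := rfl
theorem Bm_succ_succ : Bm x i.succ j.succ = if i = j then 1 else 0 := rfl
theorem Dm_zero_zero : Dm g 0 0 = 1 := rfl
theorem Dm_succ_zero : Dm g i.succ 0 = 0 := rfl
theorem Dm_zero_succ : Dm g 0 i.succ = 0 := rfl
theorem Dm_succ_succ : Dm g i.succ j.succ = - g i j := rfl

theorem mul_Bm_zero : (S * Bm x) a 0 = S a 0 := by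
  simp [Matrix.mul_apply, Fin.sum_univ_succ, Bm_zero_zero, Bm_succ_zero]

theorem mul_Bm_succ : (S * Bm x) a i.succ = S a 0 * x i + S a i.succ := by
  simp [Matrix.mul_apply, Fin.sum_univ_succ, Bm_zero_succ, Bm_succ_succ]

theorem Bm_mul_zero : ((Bm x)ᵀ * T) 0 b = T 0 b := by
  simp [Matrix.mul_apply, Fin.sum_univ_succ, Bm_zero_zero, Bm_succ_zero]

theorem Bm_mul_succ : ((Bm x)ᵀ * T) i.succ b = x i * T 0 b + T i.succ b := by
  simp [Matrix.mul_apply, Fin.sum_univ_succ, Bm_zero_succ, Bm_succ_succ]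

theorem mul_Dm_mul : (S * Dm g * T) a b
    = S a 0 * T 0 b - ∑ r, ∑ s, g r s * S a r.succ * T s.succ b := by
  have h0 : (S * Dm g) a 0 = S a 0 := by
    simp [Matrix.mul_apply, Fin.sum_univ_succ, Dm_zero_zero, Dm_succ_zero]
  have h1 : ∀ s : Fin n, (S * Dm g) a s.succ = - ∑ r, S a r.succ * g r s := fun s => by
    simp [Matrix.mul_apply, Fin.sum_univ_succ, Dm_zero_succ, Dm_succ_succ]
  rw [Matrix.mul_apply, Fin.sum_univ_succ, h0]
  simp only [h1, neg_mul, Finset.sum_neg_distrib, Finset.sum_mul]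
  rw [Finset.sum_comm, sub_eq_add_neg]
  congr 2
  exact Finset.sum_congr rfl fun r _ => Finset.sum_congr rfl fun s _ => by ring

theorem Bm_mul_Bm : Bm x * Bm (-x) = 1 := by
  ext a b
  refine Fin.cases ?_ (fun j => ?_) b
  · rw [mul_Bm_zero]
    refine Fin.cases ?_ (fun i => ?_) a
    · simp [Bm_zero_zero]
    · simp [Bm_succ_zero]
  · rw [mul_Bm_succ]
    refine Fin.cases ?_ (fun i => ?_) a
    · simp [Bm_zero_zero, Bm_zero_succ, (Fin.succ_ne_zero j).symm]
    · simp [Bm_succ_zero, Bm_succ_succ, Matrix.one_apply]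

theorem Dm_mul_Dm (h : g * g' = 1) : Dm g * Dm g' = 1 := by
  have h' : ∀ i j, ∑ k, g i k * g' k j = if i = j then 1 else 0 := fun i j => by
    rw [← Matrix.mul_apply, h, Matrix.one_apply]
  ext a b
  refine Fin.cases ?_ (fun j => ?_) b <;> refine Fin.cases ?_ (fun i => ?_) a <;>
    simp [Matrix.mul_apply, Fin.sum_univ_succ, Dm_zero_zero, Dm_succ_zero, Dm_zero_succ,
      Dm_succ_succ, Matrix.one_apply, h', (Fin.succ_ne_zero _).symm]

/-- the explicit inverse of the Hessian block matrix -/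
theorem LN_one (h : ℂ) (hh : h ≠ 0) (hg : g * g' = 1) :
    (h⁻¹ • (Bm x * Dm g * (Bm y)ᵀ)) * (h • ((Bm (-y))ᵀ * Dm g' * Bm (-x))) = 1 := by
  have h2 : (Bm y)ᵀ * (Bm (-y))ᵀ = 1 := by
    rw [← Matrix.transpose_mul]
    have := mul_eq_one_comm.mp (Bm_mul_Bm y)
    rw [this, Matrix.transpose_one]
  rw [Matrix.smul_mul, Matrix.mul_smul, smul_smul, inv_mul_cancel₀ hh, one_smul]
  calc _ = Bm x * (Dm g * ((Bm y)ᵀ * (Bm (-y))ᵀ) * Dm g') * Bm (-x) := by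
        simp only [mul_assoc]
    _ = 1 := by rw [h2, mul_one, Dm_mul_Dm _ _ hg, mul_one, Bm_mul_Bm]

end block

/-! ### The potential -/

/-- `f` for index zero, a derivative of `f` otherwise -/
def DD {n : ℕ} (c : ℂ) (a : Fin (n + 1)) (f : EuclideanSpace ℂ (Fin n) → ℂ) :
    EuclideanSpace ℂ (Fin n) → ℂ :=
  Fin.cases f (fun k => WW c k f) a

/-- the full Hessian matrix -/
def NN {n : ℕ} (f : EuclideanSpace ℂ (Fin n) → ℂ) (w : EuclideanSpace ℂ (Fin n)) :
    Matrix (Fin (n + 1)) (Fin (n + 1)) ℂ :=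
  Matrix.of fun b a => DD Complex.I b (DD (-Complex.I) a f) w

theorem Sm.dd {n : ℕ} {f : EuclideanSpace ℂ (Fin n) → ℂ} (hf : Sm f) (c : ℂ) (a) :
    Sm (DD c a f) := by
  refine Fin.cases ?_ (fun i => ?_) a
  · exact hf
  · exact hf.ww

theorem NN_ms {n : ℕ} {f : EuclideanSpace ℂ (Fin n) → ℂ} (hf : Sm f) : MS (NN f) :=
  fun b a => (hf.dd _ a).dd _ b

/-- `e^{-f}` -/
def EE {n : ℕ} (f : EuclideanSpace ℂ (Fin n) → ℂ) (w : EuclideanSpace ℂ (Fin n)) : ℂ :=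
  Complex.exp (-(f w))

/-- `a_{kl}` -/
def aa {n : ℕ} (f : EuclideanSpace ℂ (Fin n) → ℂ) (c : ℂ) (k : Fin n) (d : ℂ) (l : Fin n)
    (w : EuclideanSpace ℂ (Fin n)) : ℂ :=
  WW c k f w * WW d l f w - WW d l (WW c k f) w

section pot
variable {n : ℕ} {f : EuclideanSpace ℂ (Fin n) → ℂ} {z : EuclideanSpace ℂ (Fin n)}
  {c d e e' : ℂ} {k l s r : Fin n}

theorem EE_ne : EE f z ≠ 0 := Complex.exp_ne_zero _

theorem Sm.ee (hf : Sm f) : Sm (EE f) := ContDiffOn.cexp hf.neg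

theorem Sm.aa (hf : Sm f) : Sm (aa f c k d l) := (hf.ww.mul hf.ww).sub hf.ww.ww

theorem ww_EE (hf : Sm f) (hz : z ∈ BB n) : WW c k (EE f) z = -(WW c k f z) * EE f z := by
  have : HasFDerivAt (EE f) (Complex.exp (-(f z)) • (-(fderiv ℝ f z))) z :=
    ((hf.da hz).hasFDerivAt.fun_neg).cexp
  simp only [WW, this.fderiv, EE, _root_.smul_apply, _root_.neg_apply, smul_eq_mul]
  ring

theorem ww_mul_EE {u : EuclideanSpace ℂ (Fin n) → ℂ} (hf : Sm f) (hu : Sm u) (hz : z ∈ BB n) :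
    WW c k (fun w => u w * EE f w) z = (WW c k u z - u z * WW c k f z) * EE f z := by
  rw [ww_mul hu hf.ee hz, ww_EE hf hz]; ring

theorem ww2_EE (hf : Sm f) (hz : z ∈ BB n) :
    WW d l (WW c k (EE f)) z = aa f c k d l z * EE f z := by
  rw [ww_congr (fun w hw => ww_EE hf hw) hz, ww_mul_EE hf hf.ww.neg hz, ww_neg, _root_.aa]
  ring

theorem ww3_EE (hf : Sm f) (hz : z ∈ BB n) :
    WW e s (WW d l (WW c k (EE f))) z
      = (WW e s (aa f c k d l) z - aa f c k d l z * WW e s f z) * EE f z := by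
  rw [ww_congr (fun w hw => ww2_EE hf hw) hz, ww_mul_EE hf hf.aa hz]

theorem ww4_EE (hf : Sm f) (hz : z ∈ BB n) :
    WW e' r (WW e s (WW d l (WW c k (EE f)))) z
      = (WW e' r (WW e s (aa f c k d l)) z - WW e' r (aa f c k d l) z * WW e s f z
          - WW e s (aa f c k d l) z * WW e' r f z
          + aa f c k d l z * aa f e s e' r z) * EE f z := by
  rw [ww_congr (fun w hw => ww3_EE hf hw) hz,
    ww_mul_EE hf (hf.aa.ww.sub (hf.aa.mul hf.ww)) hz,
    ww_sub hf.aa.ww (hf.aa.mul hf.ww) hz, ww_mul hf.aa hf.ww hz]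
  simp only [_root_.aa]
  ring

theorem ww_aa (hf : Sm f) (hz : z ∈ BB n) :
    WW e s (aa f c k d l) z = WW e s (WW c k f) z * WW d l f z + WW c k f z * WW e s (WW d l f) z
      - WW d l (WW e s (WW c k f)) z := by
  change WW e s (fun w => WW c k f w * WW d l f w - WW d l (WW c k f) w) z = _
  rw [ww_sub (hf.ww.mul hf.ww) hf.ww.ww hz, ww_mul hf.ww hf.ww hz, ww_comm hf.ww hz]

theorem ww2_aa (hf : Sm f) (hz : z ∈ BB n) :
    WW e' r (WW e s (aa f c k d l)) z
      = WW e' r (WW e s (WW c k f)) z * WW d l f z + WW e s (WW c k f) z * WW e' r (WW d l f) z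
      + WW e' r (WW c k f) z * WW e s (WW d l f) z + WW c k f z * WW e' r (WW e s (WW d l f)) z
      - WW e' r (WW d l (WW e s (WW c k f))) z := by
  rw [ww_congr (fun w hw => ww_aa hf hw) hz,
    ww_sub ((hf.ww.ww.mul hf.ww).add (hf.ww.mul hf.ww.ww)) hf.ww.ww.ww hz,
    ww_add (hf.ww.ww.mul hf.ww) (hf.ww.mul hf.ww.ww) hz,
    ww_mul hf.ww.ww hf.ww hz, ww_mul hf.ww hf.ww.ww hz]
  ring

end pot

/-! ### Main computation -/

/-- the complex Hessian matrix -/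
def GG {n : ℕ} (f : EuclideanSpace ℂ (Fin n) → ℂ) (z : EuclideanSpace ℂ (Fin n)) :
    Matrix (Fin n) (Fin n) ℂ :=
  Matrix.of fun i j => WW (-Complex.I) i (WW Complex.I j f) z

/-- the explicit inverse of `NN (EE f)` -/
def LL {n : ℕ} (f : EuclideanSpace ℂ (Fin n) → ℂ) (z : EuclideanSpace ℂ (Fin n)) :
    Matrix (Fin (n + 1)) (Fin (n + 1)) ℂ :=
  (EE f z)⁻¹ • (Bm (fun p => WW (-Complex.I) p f z) * Dm ((GG f z)⁻¹)ᵀ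
    * (Bm (fun p => WW Complex.I p f z))ᵀ)

section main
variable {n : ℕ} {f : EuclideanSpace ℂ (Fin n) → ℂ} {z : EuclideanSpace ℂ (Fin n)}

theorem NN_explicit (hf : Sm f) (hz : z ∈ BB n) :
    NN (EE f) z = EE f z • ((Bm (-(fun p => WW Complex.I p f z)))ᵀ * Dm (GG f z)ᵀ
      * Bm (-(fun p => WW (-Complex.I) p f z))) := by
  ext b a
  have hd : ∀ i j : Fin n, WW Complex.I i (WW (-Complex.I) j f) z = GG f z j i :=
    fun i j => ww_comm hf hz
  rw [Matrix.smul_apply, smul_eq_mul, mul_Dm_mul]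
  refine Fin.cases ?_ (fun p => ?_) a <;> refine Fin.cases ?_ (fun q => ?_) b
  · change EE f z = _
    simp [Bm_zero_zero, Bm_succ_zero]
  · change WW Complex.I q (EE f) z = _
    rw [ww_EE hf hz]
    simp [Bm_zero_zero, Bm_succ_zero, Bm_zero_succ]; ring
  · change WW (-Complex.I) p (EE f) z = _
    rw [ww_EE hf hz]
    simp [Bm_zero_zero, Bm_succ_zero, Bm_zero_succ]; ring
  · change WW Complex.I q (WW (-Complex.I) p (EE f)) z = _
    rw [ww2_EE hf hz, aa, hd]
    simp [Bm_zero_succ, Bm_succ_succ]; ring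

theorem LL_mul_NN (hf : Sm f) (hz : z ∈ BB n) (hG : IsUnit (GG f z).det) :
    LL f z * NN (EE f) z = 1 := by
  rw [NN_explicit hf hz, LL]
  apply LN_one _ _ _ _ _ EE_ne
  rw [← Matrix.transpose_mul, Matrix.mul_nonsing_inv _ hG, Matrix.transpose_one]

theorem LL_ms (hf : Sm f) (hG : ∀ z ∈ BB n, IsUnit (GG f z).det) : MS (LL f) := by
  have h1 : ∀ z ∈ BB n, LL f z = (NN (EE f) z)⁻¹ := fun z hz =>
    (Matrix.inv_eq_left_inv (LL_mul_NN hf hz (hG z hz))).symm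
  refine MS.congr (MS.inv (NN_ms hf.ee) ?_) h1
  intro w hw
  have := congrArg Matrix.det (LL_mul_NN hf hw (hG w hw))
  rw [Matrix.det_mul, Matrix.det_one] at this
  exact IsUnit.of_mul_eq_one_right _ this

theorem alg_core (G gi : Matrix (Fin n) (Fin n) ℂ) (h1 : gi * Gᵀ = 1) (x y : Fin n → ℂ)
    (dG db : Fin n → ℂ) (p k q l : Fin n) :
    ∑ r, ∑ s, gi r s * (G r q * y l + y q * G r l - db r) * (G p s * x k + x p * G k s - dG s)
      = (G p q * x k + x p * G k q - dG q) * y l + (G p l * x k + x p * G k l - dG l) * y q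
        - x k * db p - x p * db k + ∑ r, ∑ s, gi r s * db r * dG s := by
  have e1 : ∀ r p, ∑ s, gi r s * G p s = if r = p then 1 else 0 := fun r p => by
    rw [← Matrix.one_apply, ← h1, Matrix.mul_apply]; rfl
  have h2 : Gᵀ * gi = 1 := mul_eq_one_comm.mp h1
  have e2 : ∀ q s, ∑ r, G r q * gi r s = if q = s then 1 else 0 := fun q s => by
    rw [← Matrix.one_apply, ← h2, Matrix.mul_apply]; rfl
  have e3 : ∀ (v : Fin n → ℂ) q, ∑ r, ∑ s, gi r s * G r q * v s = v q := fun v q => by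
    rw [Finset.sum_comm]
    have : ∀ s, ∑ r, gi r s * G r q * v s = (if q = s then 1 else 0) * v s := fun s => by
      rw [← e2, Finset.sum_mul]
      exact Finset.sum_congr rfl fun r _ => by ring
    simp [this]
  have e4 : ∀ (v : Fin n → ℂ) p, ∑ r, ∑ s, gi r s * v r * G p s = v p := fun v p => by
    have : ∀ r, ∑ s, gi r s * v r * G p s = (if r = p then 1 else 0) * v r := fun r => by
      rw [← e1, Finset.sum_mul]
      exact Finset.sum_congr rfl fun r _ => by ring
    simp [this]
  have a1 := e3 (fun s => G p s * x k + x p * G k s - dG s) q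
  have a2 := e3 (fun s => G p s * x k + x p * G k s - dG s) l
  have a3 := e4 db p
  have a4 := e4 db k
  rw [← a1, ← a2, ← a3, ← a4]
  simp only [Finset.sum_mul, Finset.mul_sum, ← Finset.sum_add_distrib, ← Finset.sum_sub_distrib]
  exact Finset.sum_congr rfl fun r _ => Finset.sum_congr rfl fun s _ => by ring

theorem main_iff (hf : Sm f) (hz : z ∈ BB n) (hG : IsUnit (GG f z).det) (k l : Fin n) :
    WM Complex.I l (WM (-Complex.I) k (NN (EE f))) z
      - WM Complex.I l (NN (EE f)) z * LL f z * WM (-Complex.I) k (NN (EE f)) z = 0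
    ↔ ∀ p q, - WW (-Complex.I) k (WW Complex.I l (fun w => GG f w p q)) z
        + ∑ r, ∑ s, ((GG f z)⁻¹)ᵀ r s * WW Complex.I l (fun w => GG f w r q) z
            * WW (-Complex.I) k (fun w => GG f w p s) z
        = -(GG f z p q * GG f z k l + GG f z p l * GG f z k q) := by
  have hh := hf.ee
  have hLN := LL_mul_NN hf hz hG
  have hNL : NN (EE f) z * LL f z = 1 := mul_eq_one_comm.mp hLN
  have hd : ∀ w ∈ BB n, ∀ i j : Fin n,
      WW Complex.I i (WW (-Complex.I) j f) w = GG f w j i := fun w hw i j => ww_comm hf hw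
  have hgi : ((GG f z)⁻¹)ᵀ * (GG f z)ᵀ = 1 := by
    rw [← Matrix.transpose_mul, Matrix.mul_nonsing_inv _ hG, Matrix.transpose_one]
  -- row zero
  have row0 : ∀ a, (WM Complex.I l (WM (-Complex.I) k (NN (EE f))) z
      - WM Complex.I l (NN (EE f)) z * LL f z * WM (-Complex.I) k (NN (EE f)) z) 0 a = 0 := by
    intro a
    have e : ∀ b, WM Complex.I l (NN (EE f)) z 0 b = NN (EE f) z l.succ b := fun b => rfl
    have e2 : ∀ b, (WM Complex.I l (NN (EE f)) z * LL f z) 0 b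
        = (1 : Matrix (Fin (n+1)) (Fin (n+1)) ℂ) l.succ b := fun b => by
      rw [← hNL, Matrix.mul_apply, Matrix.mul_apply]
      exact Finset.sum_congr rfl fun i _ => by rw [e]
    have e3 : (WM Complex.I l (NN (EE f)) z * LL f z * WM (-Complex.I) k (NN (EE f)) z) 0 a
        = WM (-Complex.I) k (NN (EE f)) z l.succ a := by
      rw [Matrix.mul_apply]; simp [e2, Matrix.one_apply]
    rw [Matrix.sub_apply, e3, sub_eq_zero]
    exact ww_comm (hh.dd _ a) hz
  have col0 : ∀ b, (WM Complex.I l (WM (-Complex.I) k (NN (EE f))) z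
      - WM Complex.I l (NN (EE f)) z * LL f z * WM (-Complex.I) k (NN (EE f)) z) b 0 = 0 := by
    intro b
    have e : ∀ w ∈ BB n, ∀ b, WM (-Complex.I) k (NN (EE f)) w b 0 = NN (EE f) w b k.succ := by
      intro w hw b
      refine Fin.cases rfl (fun q => ?_) b
      exact ww_comm hh hw
    have e2 : ∀ b, (LL f z * WM (-Complex.I) k (NN (EE f)) z) b 0
        = (1 : Matrix (Fin (n+1)) (Fin (n+1)) ℂ) b k.succ := fun b => by
      rw [← hLN, Matrix.mul_apply, Matrix.mul_apply]
      exact Finset.sum_congr rfl fun i _ => by rw [e z hz]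
    have e3 : (WM Complex.I l (NN (EE f)) z * LL f z * WM (-Complex.I) k (NN (EE f)) z) b 0
        = WM Complex.I l (NN (EE f)) z b k.succ := by
      rw [mul_assoc, Matrix.mul_apply]; simp [e2, Matrix.one_apply]
    rw [Matrix.sub_apply, e3, sub_eq_zero]
    exact ww_congr (fun w hw => e w hw b) hz
  have core : ∀ p q, (WM Complex.I l (WM (-Complex.I) k (NN (EE f))) z
      - WM Complex.I l (NN (EE f)) z * LL f z * WM (-Complex.I) k (NN (EE f)) z) q.succ p.succ
      = EE f z * ((- WW (-Complex.I) k (WW Complex.I l (fun w => GG f w p q)) z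
        + ∑ r, ∑ s, ((GG f z)⁻¹)ᵀ r s * WW Complex.I l (fun w => GG f w r q) z
            * WW (-Complex.I) k (fun w => GG f w p s) z)
        + (GG f z p q * GG f z k l + GG f z p l * GG f z k q)) := by
    intro p q
    set y : Fin n → ℂ := fun p => WW Complex.I p f z with hy
    set x : Fin n → ℂ := fun p => WW (-Complex.I) p f z with hx
    set av := aa f (-Complex.I) p (-Complex.I) k z with hav
    set bv := aa f Complex.I q Complex.I l z with hbv
    have hda : ∀ s, WW Complex.I s (aa f (-Complex.I) p (-Complex.I) k) z
        = GG f z p s * x k + x p * GG f z k s - WW (-Complex.I) k (fun w => GG f w p s) z := by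
      intro s
      rw [ww_aa hf hz, hd z hz, hd z hz, ww_congr (fun w hw => hd w hw s p) hz]
    have hdb : ∀ r, WW (-Complex.I) r (aa f Complex.I q Complex.I l) z
        = GG f z r q * y l + y q * GG f z r l - WW Complex.I l (fun w => GG f w r q) z := by
      intro r
      rw [ww_aa hf hz]; rfl
    have hdda : WW Complex.I l (WW Complex.I q (aa f (-Complex.I) p (-Complex.I) k)) z
        = WW Complex.I l (fun w => GG f w p q) z * x k + GG f z p q * GG f z k l
          + GG f z p l * GG f z k q + x p * WW Complex.I l (fun w => GG f w k q) z
          - WW (-Complex.I) k (WW Complex.I l (fun w => GG f w p q)) z := by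
      have hGs : Sm (fun w => GG f w p q) := hf.ww.ww
      rw [ww2_aa hf hz, hd z hz, hd z hz, hd z hz, hd z hz,
        ww_congr (fun w hw => hd w hw q p) hz, ww_congr (fun w hw => hd w hw q k) hz,
        ww_congr (fun w hw => ww_congr (fun w hw => hd w hw q p) hw) hz, ww_comm hGs hz]
    have h4 : WM Complex.I l (WM (-Complex.I) k (NN (EE f))) z q.succ p.succ
        = (WW Complex.I l (WW Complex.I q (aa f (-Complex.I) p (-Complex.I) k)) z
          - WW Complex.I l (aa f (-Complex.I) p (-Complex.I) k) z * y q
          - WW Complex.I q (aa f (-Complex.I) p (-Complex.I) k) z * y l + av * bv) * EE f z := by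
      rw [← ww4_EE hf hz]
      exact ww_congr (fun w hw => ww_comm hh.ww hw) hz
    have hS0 : (WM Complex.I l (NN (EE f)) z * Bm x) q.succ 0 = bv * EE f z := by
      rw [mul_Bm_zero]; exact ww2_EE hf hz
    have hS : ∀ r, (WM Complex.I l (NN (EE f)) z * Bm x) q.succ r.succ
        = WW (-Complex.I) r (aa f Complex.I q Complex.I l) z * EE f z := by
      intro r
      rw [mul_Bm_succ]
      have e1 : WM Complex.I l (NN (EE f)) z q.succ 0 = bv * EE f z := ww2_EE hf hz
      have e2 : WM Complex.I l (NN (EE f)) z q.succ r.succ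
          = WW (-Complex.I) r (WW Complex.I l (WW Complex.I q (EE f))) z := by
        rw [ww_comm hh.ww hz]
        exact ww_congr (fun w hw => ww_comm hh hw) hz
      rw [e1, e2, ww3_EE hf hz]; ring
    have hT0 : ((Bm y)ᵀ * WM (-Complex.I) k (NN (EE f)) z) 0 p.succ = av * EE f z := by
      rw [Bm_mul_zero]; exact ww2_EE hf hz
    have hT : ∀ s, ((Bm y)ᵀ * WM (-Complex.I) k (NN (EE f)) z) s.succ p.succ
        = WW Complex.I s (aa f (-Complex.I) p (-Complex.I) k) z * EE f z := by
      intro s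
      rw [Bm_mul_succ]
      have e1 : WM (-Complex.I) k (NN (EE f)) z 0 p.succ = av * EE f z := ww2_EE hf hz
      have e2 : WM (-Complex.I) k (NN (EE f)) z s.succ p.succ
          = WW Complex.I s (WW (-Complex.I) k (WW (-Complex.I) p (EE f))) z :=
        ww_comm hh.ww hz
      rw [e1, e2, ww3_EE hf hz]; ring
    have hprod : (WM Complex.I l (NN (EE f)) z * LL f z * WM (-Complex.I) k (NN (EE f)) z)
          q.succ p.succ
        = (av * bv - ∑ r, ∑ s, ((GG f z)⁻¹)ᵀ r s
            * WW (-Complex.I) r (aa f Complex.I q Complex.I l) z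
            * WW Complex.I s (aa f (-Complex.I) p (-Complex.I) k) z) * EE f z := by
      have e : WM Complex.I l (NN (EE f)) z * LL f z * WM (-Complex.I) k (NN (EE f)) z
          = (EE f z)⁻¹ • ((WM Complex.I l (NN (EE f)) z * Bm x) * Dm ((GG f z)⁻¹)ᵀ
            * ((Bm y)ᵀ * WM (-Complex.I) k (NN (EE f)) z)) := by
        rw [LL, Matrix.mul_smul, Matrix.smul_mul]; simp only [mul_assoc, hx, hy]
      rw [e, Matrix.smul_apply, smul_eq_mul, mul_Dm_mul, hS0, hT0]
      simp only [hS, hT]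
      have hne : EE f z ≠ 0 := EE_ne
      have e' : ∀ r s, ((GG f z)⁻¹)ᵀ r s
            * (WW (-Complex.I) r (aa f Complex.I q Complex.I l) z * EE f z)
            * (WW Complex.I s (aa f (-Complex.I) p (-Complex.I) k) z * EE f z)
          = ((GG f z)⁻¹)ᵀ r s
            * WW (-Complex.I) r (aa f Complex.I q Complex.I l) z
            * WW Complex.I s (aa f (-Complex.I) p (-Complex.I) k) z * (EE f z * EE f z) :=
        fun r s => by ring
      simp only [e', ← Finset.sum_mul]
      field_simp
    rw [Matrix.sub_apply, h4, hprod]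
    simp only [hda, hdb, hdda]
    rw [alg_core (GG f z) _ hgi x y (fun s => WW (-Complex.I) k (fun w => GG f w p s) z)
      (fun r => WW Complex.I l (fun w => GG f w r q) z) p k q l]
    ring
  constructor
  · intro h p q
    have h1 := core p q
    rw [h, Matrix.zero_apply] at h1
    rcases mul_eq_zero.mp h1.symm with h2 | h2
    · exact absurd h2 EE_ne
    · exact eq_neg_of_add_eq_zero_left h2
  · intro h
    ext b a
    refine Fin.cases (row0 a) (fun q => ?_) b
    refine Fin.cases (col0 _) (fun p => ?_) a
    rw [core, h, neg_add_cancel, mul_zero]; rfl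

end main

theorem uu_zero {n : ℕ} : (uu 0 : EuclideanSpace ℂ (Fin n) → ℂ) = fun _ => 1 := by
  funext z; simp [uu]

theorem uu_succ {n : ℕ} (i : Fin n) :
    (uu i.succ : EuclideanSpace ℂ (Fin n) → ℂ) = fun z => z i := by
  funext z; simp [uu, Fin.succ_ne_zero]

theorem uu_Bm {n : ℕ} (a : Fin (n + 1)) (z : EuclideanSpace ℂ (Fin n)) :
    uu a z = (Bm (fun i => z i))ᵀ a 0 := by
  refine Fin.cases ?_ (fun i => ?_) a
  · rw [uu_zero]; rfl
  · rw [uu_succ]; rfl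

theorem wduu_Bm {n : ℕ} (a : Fin (n + 1)) (p : Fin n) (z : EuclideanSpace ℂ (Fin n)) :
    WW (-Complex.I) p (uu a) z = (Bm (fun i => z i))ᵀ a p.succ := by
  refine Fin.cases ?_ (fun i => ?_) a
  · rw [uu_zero, ww_const, Matrix.transpose_apply, Bm_succ_zero]
  · rw [uu_succ, ww_coord, Matrix.transpose_apply, Bm_succ_succ]
    by_cases h : i = p
    · subst h; simp; norm_num
    · simp [h, Ne.symm h]

theorem Bm_ms {n : ℕ} {x : Fin n → EuclideanSpace ℂ (Fin n) → ℂ} (hx : ∀ i, Sm (x i)) :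
    MS (fun w => Bm (fun i => x i w)) := by
  intro a b
  refine Fin.cases ?_ (fun j => ?_) b
  · exact Sm.const _
  · refine Fin.cases ?_ (fun i => ?_) a
    · exact hx j
    · exact Sm.const _

theorem Bm_wm {n : ℕ} {x : Fin n → EuclideanSpace ℂ (Fin n) → ℂ} {c : ℂ} {k : Fin n}
    {z : EuclideanSpace ℂ (Fin n)} (hx : ∀ i, WW c k (x i) z = 0) :
    WM c k (fun w => Bm (fun i => x i w)) z = 0 := by
  ext a b
  refine Fin.cases ?_ (fun j => ?_) b
  · exact ww_const _
  · refine Fin.cases ?_ (fun i => ?_) a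
    · exact hx j
    · exact ww_const _

theorem conj_Bm {n : ℕ} (x : Fin n → ℂ) (a b : Fin (n + 1)) :
    (starRingEnd ℂ) (Bm x a b) = Bm (fun i => (starRingEnd ℂ) (x i)) a b := by
  refine Fin.cases ?_ (fun j => ?_) b <;> refine Fin.cases ?_ (fun i => ?_) a
  · simp [Bm_zero_zero]
  · simp [Bm_succ_zero]
  · simp [Bm_zero_succ]
  · rw [Bm_succ_succ, Bm_succ_succ]; split_ifs <;> simp

theorem K_factor {n : ℕ} {φ : EuclideanSpace ℂ (Fin n) → ℝ}
    (hf : Sm (fun w => (φ w : ℂ))) {z : EuclideanSpace ℂ (Fin n)} (hz : z ∈ BB n) :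
    (Matrix.of fun a b => Kmat (fun w => Real.exp (-(φ w))) (gmat φ) a b z)
      = (Bm (fun i => z i))ᵀ * LL (fun w => (φ w : ℂ)) z
        * Bm (fun i => (starRingEnd ℂ) (z i)) := by
  set f : EuclideanSpace ℂ (Fin n) → ℂ := fun w => (φ w : ℂ) with hfd
  have hE : (fun w => ((Real.exp (-(φ w)) : ℝ) : ℂ)) = EE f := by
    funext w; simp [EE, hfd]
  have hE' : ∀ w, ((Real.exp (-(φ w)) : ℝ) : ℂ) = EE f w := fun w => congrFun hE w
  have hgi : ginv (gmat φ) z = ((GG f z)⁻¹)ᵀ := by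
    simp only [ginv, gmat, wd_eq, wdb_eq]; rfl
  have hconj : ∀ q, (starRingEnd ℂ) (WW (-Complex.I) q f z) = WW Complex.I q f z := by
    intro q
    have h1 := ww_conj (c := Complex.I) (k := q) hf hz
    have h2 : (fun w => (starRingEnd ℂ) (f w)) = f := by funext w; simp [hfd]
    rw [h2, Complex.conj_I] at h1
    exact h1.symm
  have e : (Bm (fun i => z i))ᵀ * LL f z * Bm (fun i => (starRingEnd ℂ) (z i))
      = (EE f z)⁻¹ • (((Bm (fun i => z i))ᵀ * Bm (fun p => WW (-Complex.I) p f z))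
        * Dm ((GG f z)⁻¹)ᵀ
        * ((Bm (fun p => WW Complex.I p f z))ᵀ * Bm (fun i => (starRingEnd ℂ) (z i)))) := by
    rw [LL, Matrix.mul_smul, Matrix.smul_mul]; simp only [mul_assoc]
  ext a b
  rw [e, Matrix.smul_apply, smul_eq_mul, mul_Dm_mul, mul_Bm_zero, Bm_mul_zero, Matrix.of_apply,
    Kmat]
  simp only [mul_Bm_succ, Bm_mul_succ, hE', wd_eq, hgi, ww_EE hf hz, map_sub, map_mul, map_neg,
    map_inv₀, hconj, wduu_Bm, uu_Bm, Matrix.transpose_apply, conj_Bm]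
  have hne : EE f z ≠ 0 := EE_ne
  have hre : (starRingEnd ℂ) (EE f z) = EE f z := by
    rw [← hE', Complex.conj_ofReal]
  have s1 : ∀ u v : ℂ, u * (EE f z)⁻¹ * (-v * EE f z) = -(u * v) := fun u v => by
    field_simp
  simp only [hre, s1]
  rw [mul_sub]
  congr 1
  · ring
  · congr 1
    exact Finset.sum_congr rfl fun r _ => Finset.sum_congr rfl fun s _ => by ring

/-- The signature-`(1,n)` Hermitian matrix `K` built from
`h = exp(−φ)` on the unit ball (assumed invertible throughout) is flat if and only if
`g` has constant holomorphic sectional curvature `κ = −2`. -/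
theorem K_flat_iff_chsc_neg_two (n : ℕ) (φ : EuclideanSpace ℂ (Fin n) → ℝ)
    (hφ : ContDiffOn ℝ (⊤ : ℕ∞) φ (Metric.ball 0 1))
    (hpos : ∀ z ∈ Metric.ball (0 : EuclideanSpace ℂ (Fin n)) 1,
      (Matrix.of fun i j => gmat φ i j z).PosDef)
    (hKinv : ∀ z ∈ Metric.ball (0 : EuclideanSpace ℂ (Fin n)) 1,
      IsUnit (Matrix.of fun a b => Kmat (fun w => Real.exp (-(φ w))) (gmat φ) a b z).det) :
    (∀ z ∈ Metric.ball (0 : EuclideanSpace ℂ (Fin n)) 1, ∀ k l : Fin n,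
        FK (fun w => Real.exp (-(φ w))) (gmat φ) k l z = 0)
      ↔ (∀ z ∈ Metric.ball (0 : EuclideanSpace ℂ (Fin n)) 1, ∀ i j k l : Fin n,
          Riem (gmat φ) i j k l z
            = -(gmat φ i j z * gmat φ k l z + gmat φ i l z * gmat φ k j z)) := by
  set f : EuclideanSpace ℂ (Fin n) → ℂ := fun w => (φ w : ℂ) with hfd
  have hf : Sm f := Complex.ofRealCLM.contDiff.comp_contDiffOn hφ
  have hgm : ∀ i j, gmat φ i j = fun w => GG f w i j := by
    intro i j; funext w; simp only [gmat, wd_eq, wdb_eq]; rfl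
  have hG : ∀ z ∈ BB n, IsUnit (GG f z).det := by
    intro z hz
    have h1 := (hpos z hz).isUnit
    rw [Matrix.isUnit_iff_isUnit_det] at h1
    have h2 : (Matrix.of fun i j => gmat φ i j z) = GG f z := by
      ext i j; rw [Matrix.of_apply, hgm]
    rwa [h2] at h1
  have hF : ∀ z ∈ BB n, ∀ k l : Fin n,
      FK (fun w => Real.exp (-(φ w))) (gmat φ) k l z = 0 ↔
      WM Complex.I l (WM (-Complex.I) k (NN (EE f))) z
      - WM Complex.I l (NN (EE f)) z * LL f z * WM (-Complex.I) k (NN (EE f)) z = 0 := by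
    intro z hz k l
    have hFK : FK (fun w => Real.exp (-(φ w))) (gmat φ) k l z
        = WM Complex.I l (fun w => WM (-Complex.I) k
            (fun w => Matrix.of fun a b => Kmat (fun w => Real.exp (-(φ w))) (gmat φ) a b w) w
          * (Matrix.of fun a b => Kmat (fun w => Real.exp (-(φ w))) (gmat φ) a b w)⁻¹) z := by
      simp only [FK, wd_eq, wdb_eq]; rfl
    rw [hFK]
    have hcz : ∀ i, Sm (fun w : EuclideanSpace ℂ (Fin n) => w i) := Sm.coord
    have hBz : MS (fun w : EuclideanSpace ℂ (Fin n) => Bm (fun i => w i)) := Bm_ms hcz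
    have hBz' : MS (fun w : EuclideanSpace ℂ (Fin n) => Bm (fun i => -(w i))) :=
      Bm_ms fun i => (hcz i).neg
    refine flat_iff (A := fun w => (Bm (fun i => w i))ᵀ) (L := LL f)
      (C := fun w => Bm (fun i => (starRingEnd ℂ) (w i))) (N := NN (EE f))
      (A' := fun w => (Bm (fun i => -(w i)))ᵀ)
      (C' := fun w => Bm (fun i => -(starRingEnd ℂ) (w i)))
      (fun a b => hBz b a) (LL_ms hf hG) (Bm_ms fun i => (hcz i).conj) (NN_ms hf.ee)
      (fun a b => hBz' b a) (fun w hw => K_factor hf hw) ?_ ?_ ?_ ?_ ?_ hz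
    · intro w hw
      have h1 : Bm (fun i => -(w i)) * Bm (fun i => w i) = 1 :=
        mul_eq_one_comm.mp (Bm_mul_Bm (fun i => w i))
      rw [← Matrix.transpose_mul, h1, Matrix.transpose_one]
    · intro w hw
      exact Bm_mul_Bm _
    · intro w hw
      exact LL_mul_NN hf hw (hG w hw)
    · intro w hw
      apply Bm_wm
      intro i
      rw [ww_conj (hcz i) hw, ww_coord]
      simp
    · intro w hw
      have h1 : WM Complex.I l (fun w : EuclideanSpace ℂ (Fin n) => Bm (fun i => w i)) w = 0 := by
        apply Bm_wm
        intro i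
        rw [ww_coord]
        simp
      ext a b
      exact congrFun (congrFun h1 b) a
  have hR : ∀ z, ∀ i j k l : Fin n, Riem (gmat φ) i j k l z
      = - WW (-Complex.I) k (WW Complex.I l (fun w => GG f w i j)) z
        + ∑ r, ∑ s, ((GG f z)⁻¹)ᵀ r s * WW Complex.I l (fun w => GG f w r j) z
            * WW (-Complex.I) k (fun w => GG f w i s) z := by
    intro z i j k l
    simp only [Riem, ginv, hgm, wd_eq, wdb_eq]; rfl
  constructor
  · intro h z hz i j k l
    rw [hR]
    simp only [hgm]
    exact (main_iff hf hz (hG z hz) k l).mp ((hF z hz k l).mp (h z hz k l)) i j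
  · intro h z hz k l
    rw [hF z hz, main_iff hf hz (hG z hz)]
    intro p q
    have h1 := h z hz p q k l
    rw [hR] at h1
    simp only [hgm] at h1
    exact h1
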